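/- arXiv:2603.03139 — 2 statements merged into one kernel-verified Lean document; each statement's English description precedes it below -/
import Mathlib

section
/- Let q, s ≥ 1 be integers and suppose z = (z_1,…,z_q) ∈ ℕ^q satisfies min_j z_j ≥ s−1 and ‖z‖_1 + min_j z_j ≥ (q+13)(s−1), where ‖z‖_1 = Σ_j z_j. For all t = (t_1,…,t_q) ∈ ℕ_+^q and all n ≥ ‖t‖_∞ + Λ_t + 1, if G is an n-vertex s-connector then G → (t−z)^+ K_2, where (t−z)^+ is the vector with j-th coordinate max(t_j − z_j, 0). -/
open SimpleGraph

variable {V : Type*}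

/-- `M` is a set of edges of `G` forming a matching (pairwise disjoint edges). -/
def IsMatchingSet (G : SimpleGraph V) (M : Finset (Sym2 V)) : Prop :=
  (∀ e ∈ M, e ∈ G.edgeSet) ∧
    ∀ e ∈ M, ∀ f ∈ M, e ≠ f → ∀ v : V, v ∈ e → v ∉ f

/-- The matching number `ν(G)`. -/
noncomputable def matchingNumber (G : SimpleGraph V) : ℕ :=
  sSup {n | ∃ M : Finset (Sym2 V), IsMatchingSet G M ∧ M.card = n}

/-- `ν_G(X,Y)`: the maximum size of a matching of `G` each edge of which has one
endpoint in `X` and one endpoint in `Y`. -/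
noncomputable def nuBetween (G : SimpleGraph V) (X Y : Set V) : ℕ :=
  sSup {n | ∃ M : Finset (Sym2 V), IsMatchingSet G M ∧ M.card = n ∧
    ∀ e ∈ M, ∃ x ∈ X, ∃ y ∈ Y, e = s(x, y)}

/-- The set `D` of the Gallai–Edmonds decomposition: the inessential vertices,
i.e. those missed by some maximum matching. -/
def geD (G : SimpleGraph V) : Set V :=
  {v | ∃ M : Finset (Sym2 V), IsMatchingSet G M ∧ M.card = matchingNumber G ∧ ∀ e ∈ M, v ∉ e}

/-- The set `A` of the Gallai–Edmonds decomposition: vertices outside `D` with a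
neighbour in `D`. -/
def geA (G : SimpleGraph V) : Set V :=
  {v | v ∉ geD G ∧ ∃ u ∈ geD G, G.Adj v u}

/-- The set `C` of the Gallai–Edmonds decomposition: the remaining vertices. -/
def geC (G : SimpleGraph V) : Set V :=
  {v | v ∉ geD G ∧ v ∉ geA G}

/-- `G` is an `s`-connector: any two disjoint vertex sets of size at least `s`
are joined by an edge. -/
def IsConnector (G : SimpleGraph V) (s : ℕ) : Prop :=
  ∀ X Y : Set V, Disjoint X Y → s ≤ X.ncard → s ≤ Y.ncard →
    ∃ x ∈ X, ∃ y ∈ Y, G.Adj x y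

/-- `G → (t₁K₂, …, t_qK₂)`: every `q`-colouring of the edges of `G` admits a colour
`j` and a `j`-monochromatic matching of size `t j`. -/
def ArrowsMatch (G : SimpleGraph V) {q : ℕ} (t : Fin q → ℕ) : Prop :=
  ∀ c : Sym2 V → Fin q, ∃ j : Fin q, ∃ M : Finset (Sym2 V),
    IsMatchingSet G M ∧ M.card = t j ∧ ∀ e ∈ M, c e = j

/-- The induced subgraph `G[S]`, viewed as a graph on the same vertex set. -/
def inducedOn (G : SimpleGraph V) (S : Set V) : SimpleGraph V where
  Adj a b := G.Adj a b ∧ a ∈ S ∧ b ∈ S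
  symm := ⟨fun _ _ ⟨h, ha, hb⟩ => ⟨h.symm, hb, ha⟩⟩
  loopless := ⟨fun a h => G.loopless.irrefl a h.1⟩

/-- Remove from `G` every edge incident to `S`. -/
def removeIncident (G : SimpleGraph V) (S : Set V) : SimpleGraph V where
  Adj a b := G.Adj a b ∧ a ∉ S ∧ b ∉ S
  symm := ⟨fun _ _ ⟨h, ha, hb⟩ => ⟨h.symm, hb, ha⟩⟩
  loopless := ⟨fun a h => G.loopless.irrefl a h.1⟩

/-- The subgraph of `G` consisting of the edges incident to `S`. -/
def incidentSub (G : SimpleGraph V) (S : Set V) : SimpleGraph V where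
  Adj a b := G.Adj a b ∧ (a ∈ S ∨ b ∈ S)
  symm := ⟨fun _ _ ⟨h, hs⟩ => ⟨h.symm, hs.symm⟩⟩
  loopless := ⟨fun a h => G.loopless.irrefl a h.1⟩

/-- The vertex set of the connected component of `v` in `G`. -/
def compSet (G : SimpleGraph V) (v : V) : Set V := {u | G.Reachable u v}

/-- The family of vertex sets of the connected components of `G[S]` meeting `S`. -/
def compsOn (G : SimpleGraph V) (S : Set V) : Set (Set V) :=
  {K | ∃ v ∈ S, K = compSet (inducedOn G S) v}

/-- `G[S]` is factor-critical: for every `v ∈ S` there is a matching of `G[S]`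
avoiding `v` and covering all other vertices of `S`. -/
def IsFactorCriticalOn (G : SimpleGraph V) (S : Set V) : Prop :=
  ∀ v ∈ S, ∃ M : Finset (Sym2 V), IsMatchingSet (inducedOn G S) M ∧
    (∀ e ∈ M, v ∉ e) ∧ ∀ u ∈ S, u ≠ v → ∃ e ∈ M, u ∈ e

/-- The bipartite incidence graph of an indexed (multi)hypergraph. -/
def incGraph {ι : Type*} (E : ι → Set V) : SimpleGraph (V ⊕ ι) where
  Adj x y :=
    (∃ v i, x = Sum.inl v ∧ y = Sum.inr i ∧ v ∈ E i) ∨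
    (∃ v i, x = Sum.inr i ∧ y = Sum.inl v ∧ v ∈ E i)
  symm := by
    refine ⟨?_⟩
    rintro x y (⟨v, i, rfl, rfl, h⟩ | ⟨v, i, rfl, rfl, h⟩)
    · exact Or.inr ⟨v, i, rfl, rfl, h⟩
    · exact Or.inl ⟨v, i, rfl, rfl, h⟩
  loopless := by
    refine ⟨?_⟩
    rintro x (⟨v, i, rfl, h, -⟩ | ⟨v, i, rfl, h, -⟩) <;> simp at h

/-- An indexed (multi)hypergraph is a hyperforest if its incidence graph has no cycle. -/
def IsHyperforest {ι : Type*} (E : ι → Set V) : Prop := (incGraph E).IsAcyclic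

/-- Index type of the multihypergraph `𝒞(𝒢)` of monochromatic connected components:
a colour together with the vertex set of a component of that colour graph. -/
def CompIdx {q : ℕ} (Gc : Fin q → SimpleGraph V) : Type _ :=
  Σ j : Fin q, {K : Set V // ∃ v : V, K = compSet (Gc j) v}

/-- The hyperedges of the multihypergraph `𝒞(𝒢)`. -/
def CompEdge {q : ℕ} (Gc : Fin q → SimpleGraph V) : CompIdx Gc → Set V :=
  fun p => (p.2 : Set V)

/-- A coloured graph is acyclic if `𝒞(𝒢)` is a hyperforest. -/
def ColouringAcyclic {q : ℕ} (Gc : Fin q → SimpleGraph V) : Prop :=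
  IsHyperforest (CompEdge Gc)

/-- `(G₀, G₁, …, G_q)` is a `q`-multicolouring of `G`: the union of all
(coloured and uncoloured) edge sets is the edge set of `G`. -/
def IsMulticolouring (G G0 : SimpleGraph V) {q : ℕ} (Gc : Fin q → SimpleGraph V) : Prop :=
  G0 ⊔ (⨆ j, Gc j) = G

/-- The colouring `(G₀, G₁, …, G_q)` of `G` is `S`-proper: the uncoloured edges are
exactly the edges of `G` incident to `S`, and they carry no colour. -/
def IsSProper (G G0 : SimpleGraph V) {q : ℕ} (Gc : Fin q → SimpleGraph V) (S : Set V) : Prop :=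
  G0.edgeSet = {e | e ∈ G.edgeSet ∧ ∃ v ∈ S, v ∈ e} ∧
    ∀ j, Disjoint G0.edgeSet (Gc j).edgeSet

/-- The potential `σ_𝒢(T) = r_𝒢(T) - |T|`, where
`r_𝒢(T) = ∑_j |A_j ∩ T| + ∑_j ∑_i (ν(G_j[K_j^i]) - ν(G_j[K_j^i ∖ T]))`,
the inner sum running over the components `K_j^i` of `G_j[D_j]`. -/
noncomputable def sigmaCol {q : ℕ} (Gc : Fin q → SimpleGraph V) (T : Set V) : ℤ :=
  ((∑ j : Fin q, ((geA (Gc j) ∩ T).ncard : ℤ))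
    + ∑ j : Fin q, ∑ᶠ K ∈ compsOn (Gc j) (geD (Gc j)),
        ((matchingNumber (inducedOn (Gc j) K) : ℤ)
          - (matchingNumber (inducedOn (Gc j) (K \ T)) : ℤ)))
    - (T.ncard : ℤ)

/-- `T` is `σ_𝒢`-maximal. -/
def SigmaMaximal {q : ℕ} (Gc : Fin q → SimpleGraph V) (T : Set V) : Prop :=
  (∀ S : Set V, sigmaCol Gc S ≤ sigmaCol Gc T) ∧
    ∀ T' : Set V, T ⊂ T' → sigmaCol Gc T' < sigmaCol Gc T

section Combinatorics

open Finset

/-- If no fibre of `f` contains almost all of `S`, then `S` can be cut along fibres of `f` into two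
large pieces. -/
lemma exists_balanced_preimage {α γ : Type*} [DecidableEq γ] (S : Finset α) (f : α → γ) (m : ℕ)
    (hS : 3 * m < #S) (hf : ∀ c, m < #{v ∈ S | f v ≠ c}) :
    ∃ P : Finset γ, m < #{v ∈ S | f v ∈ P} ∧ m < #{v ∈ S | f v ∉ P} := by
  by_cases h : ∃ c, m < #{v ∈ S | f v = c}
  · obtain ⟨c, hc⟩ := h
    exact ⟨{c}, by simpa using hc, by simpa using hf c⟩
  push Not at h
  have hex : ∃ n, ∃ P : Finset γ, #P = n ∧ m < #{v ∈ S | f v ∈ P} := by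
    refine ⟨_, S.image f, rfl, ?_⟩
    rw [filter_true_of_mem fun v hv => mem_image_of_mem f hv]
    omega
  classical
  obtain ⟨P, hPn, hP⟩ := Nat.find_spec hex
  obtain ⟨v, hv⟩ := card_pos.1 (by omega : 0 < #{v ∈ S | f v ∈ P})
  obtain ⟨-, hvP⟩ := mem_filter.1 hv
  have herase : #{w ∈ S | f w ∈ P.erase (f v)} ≤ m := by
    by_contra hlt
    refine Nat.find_min hex (m := #(P.erase (f v))) ?_ ⟨_, rfl, by omega⟩
    rw [← hPn]
    exact card_erase_lt_of_mem hvP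
  have hle : #{w ∈ S | f w ∈ P} ≤ #{w ∈ S | f w ∈ P.erase (f v)} + #{w ∈ S | f w = f v} := by
    refine (card_le_card fun w hw => ?_).trans (card_union_le _ _)
    simp only [mem_union, mem_filter, mem_erase] at hw ⊢
    tauto
  have hsum := card_filter_add_card_filter_not (s := S) (fun w => f w ∈ P)
  have := h (f v)
  exact ⟨P, hP, by omega⟩

/-- If points of `S` carry two labels, and related points always agree in one of them, then `S` is
small unless nearly all its points share the second label. -/
lemma card_le_or_exists_common_label {α γ : Type*} [DecidableEq α] [DecidableEq γ] {k : ℕ}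
    {r : α → α → Prop}
    (hr : ∀ X Y : Finset α, Disjoint X Y → k < #X → k < #Y → ∃ x ∈ X, ∃ y ∈ Y, r x y)
    (S : Finset α) (f g : α → γ) (hf : ∀ c, #{v ∈ S | f v = c} ≤ k)
    (hfg : ∀ x ∈ S, ∀ y ∈ S, x ≠ y → r x y → f x = f y ∨ g x = g y) :
    #S ≤ 6 * k ∨ ∃ c, #{v ∈ S | g v ≠ c} ≤ 2 * k := by
  by_contra! h
  obtain ⟨hS, hg⟩ := h
  obtain ⟨P, hP, hP'⟩ := exists_balanced_preimage S f (2 * k) (by omega) fun c => by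
    have := card_filter_add_card_filter_not (s := S) (fun w => f w = c)
    have := hf c
    simp only [ne_eq]
    omega
  obtain ⟨Q, hQ, hQ'⟩ := exists_balanced_preimage S g (2 * k) (by omega) hg
  have cross : ∀ X Y : Finset α, X ⊆ S → Y ⊆ S → (∀ x ∈ X, ∀ y ∈ Y, f x ≠ f y ∧ g x ≠ g y) →
      k < #X → k < #Y → False := by
    intro X Y hXS hYS hne hX hY
    have hd : Disjoint X Y := disjoint_left.2 fun x hx hy => (hne x hx x hy).1 rfl
    obtain ⟨x, hx, y, hy, hxy⟩ := hr X Y hd hX hY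
    rcases hfg x (hXS hx) y (hYS hy) (fun h => (hne x hx y hy).1 (h ▸ rfl)) hxy with h | h
    · exact (hne x hx y hy).1 h
    · exact (hne x hx y hy).2 h
  have e1 := card_filter_add_card_filter_not (s := {v ∈ S | f v ∈ P}) (fun w => g w ∈ Q)
  have e2 := card_filter_add_card_filter_not (s := {v ∈ S | f v ∉ P}) (fun w => g w ∈ Q)
  have e3 := card_filter_add_card_filter_not (s := {v ∈ S | g v ∈ Q}) (fun w => f w ∈ P)
  have e4 := card_filter_add_card_filter_not (s := {v ∈ S | g v ∉ Q}) (fun w => f w ∈ P)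
  rw [filter_filter, filter_filter] at e1 e2 e3 e4
  simp only [and_comm (a := g _ ∈ Q), and_comm (a := g _ ∉ Q)] at e3 e4
  have c1 := cross {v ∈ S | f v ∈ P ∧ g v ∈ Q} {v ∈ S | f v ∉ P ∧ g v ∉ Q} (filter_subset _ _)
    (filter_subset _ _) (by grind)
  have c2 := cross {v ∈ S | f v ∈ P ∧ g v ∉ Q} {v ∈ S | f v ∉ P ∧ g v ∈ Q} (filter_subset _ _)
    (filter_subset _ _) (by grind)
  by_cases h1 : k < #{v ∈ S | f v ∈ P ∧ g v ∈ Q}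
  · by_cases h2 : k < #{v ∈ S | f v ∉ P ∧ g v ∉ Q}
    · exact c1 h1 h2
    · exact c2 (by omega) (by omega)
  · exact c2 (by omega) (by omega)

/-- A large set is related to all but `k` vertices. -/
lemma card_le_card_add_of_connector {α : Type*} [Fintype α] [DecidableEq α] {k : ℕ}
    {r : α → α → Prop}
    (hr : ∀ X Y : Finset α, Disjoint X Y → k < #X → k < #Y → ∃ x ∈ X, ∃ y ∈ Y, r x y)
    {X N : Finset α} (hX : k < #X) (hXN : X ⊆ N) (hN : ∀ x ∈ X, ∀ y, r x y → y ∈ N) :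
    Fintype.card α ≤ #N + k := by
  by_contra! h
  have := card_compl_add_card N
  obtain ⟨x, hx, y, hy, hxy⟩ := hr X Nᶜ
    (disjoint_left.2 fun x hx hx' => (mem_compl.1 hx') (hXN hx)) hX (by omega)
  exact mem_compl.1 hy (hN x hx y hxy)

/-- Suppose every point `v` of `W` is only related to points of `K v ∪ L v`, where `K v` and `L v`
are both smaller than half of the vertex set.  In a connector, the total of the reciprocals of the
sizes of these sets is small. -/
lemma sum_inv_card_le {α : Type*} [Fintype α] [DecidableEq α] {k : ℕ} {r : α → α → Prop}
    (hr : ∀ X Y : Finset α, Disjoint X Y → k < #X → k < #Y → ∃ x ∈ X, ∃ y ∈ Y, r x y)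
    (W : Finset α) (K L : α → Finset α) (hvK : ∀ v ∈ W, v ∈ K v) (hvL : ∀ v ∈ W, v ∈ L v)
    (hLK : ∀ v ∈ W, #(L v) ≤ #(K v)) (hK : ∀ v ∈ W, 2 * #(K v) + 13 * k < Fintype.card α)
    (hN : ∀ x ∈ W, ∀ y, r x y → y ∈ K x ∪ L x)
    (hshare : ∀ x ∈ W, ∀ y ∈ W, x ≠ y → r x y →
      K x = K y ∨ L x = L y ∨ K x = L y ∨ L x = K y) :
    ∑ v ∈ W, (1 / (2 * #(K v) : ℚ) + 1 / (2 * #(L v))) ≤ 14 * k := by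
  rcases W.eq_empty_or_nonempty with rfl | ⟨w, hw⟩
  · simp
  have hn : 13 * k < Fintype.card α := by have := hK w hw; omega
  obtain rfl | hk := Nat.eq_zero_or_pos k
  · exfalso
    have := card_le_card_add_of_connector hr (X := {w}) (N := K w ∪ L w) (by simp)
      (by simp [hvK w hw]) (by simpa using hN w hw)
    have := card_union_le (K w) (L w)
    have := hLK w hw
    have := hK w hw
    omega
  set n := Fintype.card α with hndef
  have big : ∀ C : Finset α, n ≤ 4 * (k + 1) * #C → (1 / (2 * #C) : ℚ) ≤ 2 * (k + 1) / n := by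
    intro C hC
    have hCpos : (0 : ℚ) < #C := by
      rcases Nat.eq_zero_or_pos #C with h | h
      · rw [h] at hC; omega
      · exact_mod_cast h
    have hnpos : (0 : ℚ) < n := by exact_mod_cast (by omega : 0 < n)
    have : (n : ℚ) ≤ 4 * (k + 1) * #C := by exact_mod_cast hC
    rw [div_le_div_iff₀ (by positivity) hnpos]
    linarith
  have half : ∀ C : Finset α, C.Nonempty → (1 / (2 * #C) : ℚ) ≤ 1 / 2 := by
    intro C hC
    have : (1 : ℚ) ≤ #C := by exact_mod_cast hC.card_pos
    rw [div_le_div_iff₀ (by positivity) (by norm_num)]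
    linarith
  -- points for which both sets are small
  have small : #{v ∈ W | 4 * (k + 1) * #(K v) < n} ≤ k := by
    by_contra! h
    obtain ⟨X, hX, hXc⟩ := exists_subset_card_eq (Nat.succ_le_of_lt h)
    have hb := card_le_card_add_of_connector hr (X := X) (N := X.biUnion fun v => K v ∪ L v)
      (by omega)
      (fun x hx => mem_biUnion.2 ⟨x, hx, mem_union_left _ (hvK x (mem_filter.1 (hX hx)).1)⟩)
      (fun x hx y hxy => mem_biUnion.2 ⟨x, hx, hN x (mem_filter.1 (hX hx)).1 y hxy⟩)
    have hs : 2 * (k + 1) * #(X.biUnion fun v => K v ∪ L v) ≤ (k + 1) * n := by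
      calc 2 * (k + 1) * #(X.biUnion fun v => K v ∪ L v)
          ≤ 2 * (k + 1) * ∑ v ∈ X, #(K v ∪ L v) := Nat.mul_le_mul_left _ card_biUnion_le
        _ = ∑ v ∈ X, 2 * (k + 1) * #(K v ∪ L v) := mul_sum _ _ _
        _ ≤ ∑ v ∈ X, n := sum_le_sum fun v hv => by
            obtain ⟨hvW, hvs⟩ := mem_filter.1 (hX hv)
            have h2 : #(K v ∪ L v) ≤ 2 * #(K v) := by
              have := card_union_le (K v) (L v)
              have := hLK v hvW
              omega
            nlinarith
        _ = (k + 1) * n := by simp [hXc]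
    have : 2 * #(X.biUnion fun v => K v ∪ L v) ≤ n := by nlinarith
    omega
  set S := {v ∈ W | n ≤ 4 * (k + 1) * #(K v) ∧ 4 * (k + 1) * #(L v) < n} with hSdef
  have fibre : ∀ C, #{v ∈ S | K v = C} ≤ k := by
    intro C
    by_contra! h
    obtain ⟨X, hX, hXc⟩ := exists_subset_card_eq (Nat.succ_le_of_lt h)
    have hXS : ∀ x ∈ X, x ∈ W ∧ 4 * (k + 1) * #(L x) < n ∧ K x = C := fun x hx => by
      have := hX hx
      simp only [hSdef, mem_filter] at this
      tauto
    have hb := card_le_card_add_of_connector hr (X := X) (N := C ∪ X.biUnion L) (by omega)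
      (fun x hx => mem_union_right _ (mem_biUnion.2 ⟨x, hx, hvL x (hXS x hx).1⟩))
      (fun x hx y hxy => by
        have := hN x (hXS x hx).1 y hxy
        rw [(hXS x hx).2.2] at this
        rcases mem_union.1 this with h | h
        · exact mem_union_left _ h
        · exact mem_union_right _ (mem_biUnion.2 ⟨x, hx, h⟩))
    have hs : 4 * (k + 1) * #(X.biUnion L) ≤ (k + 1) * n := by
      calc 4 * (k + 1) * #(X.biUnion L)
          ≤ 4 * (k + 1) * ∑ v ∈ X, #(L v) := Nat.mul_le_mul_left _ card_biUnion_le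
        _ = ∑ v ∈ X, 4 * (k + 1) * #(L v) := mul_sum _ _ _
        _ ≤ ∑ v ∈ X, n := sum_le_sum fun v hv => (hXS v hv).2.1.le
        _ = (k + 1) * n := by simp [hXc]
    have h4 : 4 * #(X.biUnion L) ≤ n := by nlinarith
    obtain ⟨x, hx⟩ := card_pos.1 (by omega : 0 < #X)
    have h5 := hK x (hXS x hx).1
    rw [(hXS x hx).2.2] at h5
    have := card_union_le C (X.biUnion L)
    omega
  have medium : ∑ v ∈ S, (1 / (2 * #(L v)) : ℚ) ≤ 3 * k := by
    have hSW : ∀ v ∈ S, v ∈ W := fun v hv => (mem_filter.1 hv).1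
    have crude : ∀ T ⊆ S, ∑ v ∈ T, (1 / (2 * #(L v)) : ℚ) ≤ #T / 2 := fun T hT => by
      calc ∑ v ∈ T, (1 / (2 * #(L v)) : ℚ) ≤ ∑ v ∈ T, (1 / 2 : ℚ) :=
            sum_le_sum fun v hv => half _ ⟨v, hvL v (hSW v (hT hv))⟩
        _ = #T / 2 := by simp [div_eq_mul_inv]
    rcases card_le_or_exists_common_label hr S K L fibre (fun x hx y hy hne hxy => by
      have hx' := mem_filter.1 hx
      have hy' := mem_filter.1 hy
      rcases hshare x hx'.1 y hy'.1 hne hxy with h | h | h | h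
      · exact Or.inl h
      · exact Or.inr h
      · rw [h] at hx'; omega
      · rw [h] at hx'; omega) with h | ⟨C, hC⟩
    · have : (#S : ℚ) ≤ 6 * k := by exact_mod_cast h
      linarith [crude S subset_rfl]
    · rw [← sum_filter_add_sum_filter_not S (fun v => L v = C)]
      have h1 : ∑ v ∈ S with L v = C, (1 / (2 * #(L v)) : ℚ) ≤ 1 / 2 := by
        have hsub : #{v ∈ S | L v = C} ≤ #C := card_le_card fun v hv => by
          obtain ⟨hvS, rfl⟩ := mem_filter.1 hv
          exact hvL v (hSW v hvS)
        rw [sum_congr rfl fun v hv => by rw [(mem_filter.1 hv).2], sum_const, nsmul_eq_mul]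
        rcases Nat.eq_zero_or_pos #C with h0 | h0
        · simp [h0]
        · have h0' : (0 : ℚ) < #C := by exact_mod_cast h0
          have : (#{v ∈ S | L v = C} : ℚ) ≤ #C := by exact_mod_cast hsub
          rw [mul_one_div, div_le_div_iff₀ (by positivity) (by norm_num)]
          linarith
      have h2 := crude {v ∈ S | ¬ L v = C} (filter_subset _ _)
      have h3 : (#{v ∈ S | ¬ L v = C} : ℚ) ≤ 2 * k := by exact_mod_cast hC
      have h4 : (1 : ℚ) ≤ k := by exact_mod_cast hk
      linarith
  have bound : ∀ v ∈ W, (1 / (2 * #(K v) : ℚ) + 1 / (2 * #(L v))) ≤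
      4 * (k + 1) / n + (if 4 * (k + 1) * #(K v) < n then 1 else 0) +
        (if n ≤ 4 * (k + 1) * #(K v) ∧ 4 * (k + 1) * #(L v) < n
          then 1 / (2 * #(L v) : ℚ) else 0) := by
    intro v hv
    have e : (4 * (k + 1) / n : ℚ) = 2 * (k + 1) / n + 2 * (k + 1) / n := by ring
    have hpos : (0 : ℚ) ≤ 2 * (k + 1) / n := by positivity
    by_cases hKs : 4 * (k + 1) * #(K v) < n
    · rw [if_pos hKs, if_neg (by omega)]
      linarith [half _ ⟨v, hvK v hv⟩, half _ ⟨v, hvL v hv⟩]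
    · rw [if_neg hKs]
      by_cases hLs : 4 * (k + 1) * #(L v) < n
      · rw [if_pos ⟨by omega, hLs⟩]
        linarith [big (K v) (by omega)]
      · rw [if_neg (by tauto)]
        linarith [big (K v) (by omega), big (L v) (by omega)]
  refine (sum_le_sum bound).trans ?_
  rw [sum_add_distrib, sum_add_distrib, ← sum_filter, ← sum_filter, ← hSdef]
  have t1 : ∑ v ∈ W, (4 * (k + 1) / n : ℚ) ≤ 4 * (k + 1) := by
    have hnpos : (0 : ℚ) < n := by exact_mod_cast (by omega : 0 < n)
    have hWn : (#W : ℚ) ≤ n := by exact_mod_cast card_le_univ W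
    rw [sum_const, nsmul_eq_mul, mul_div_assoc', div_le_iff₀ hnpos]
    have : (0 : ℚ) ≤ 4 * (k + 1) := by positivity
    nlinarith
  have t2 : ∑ v ∈ W with 4 * (k + 1) * #(K v) < n, (1 : ℚ) ≤ k := by
    rw [sum_const, nsmul_eq_mul, mul_one]
    exact_mod_cast small
  have h4 : (1 : ℚ) ≤ k := by exact_mod_cast hk
  linarith

end Combinatorics

section Partitions

open Finset

/-- In a connector, two disjoint sets are joined by a matching that is nearly as large as the
smaller of them. -/
lemma exists_pairs_of_connector {α : Type*} [DecidableEq α] {k : ℕ} {r : α → α → Prop}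
    (hr : ∀ X Y : Finset α, Disjoint X Y → k < #X → k < #Y → ∃ x ∈ X, ∃ y ∈ Y, r x y)
    {X Y : Finset α} (hXY : Disjoint X Y) (d : ℕ) (hX : d + k ≤ #X) (hY : d + k ≤ #Y) :
    ∃ P : Finset (α × α), #P = d ∧ (∀ e ∈ P, e.1 ∈ X ∧ e.2 ∈ Y ∧ r e.1 e.2) ∧
      Set.InjOn Prod.fst (P : Set (α × α)) ∧ Set.InjOn Prod.snd (P : Set (α × α)) := by
  induction d with
  | zero => exact ⟨∅, by simp⟩
  | succ d ih =>
    obtain ⟨P, hPd, hP, hfst, hsnd⟩ := ih (by omega) (by omega)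
    have c1 : #(P.image Prod.fst) ≤ d := hPd ▸ card_image_le
    have c2 : #(P.image Prod.snd) ≤ d := hPd ▸ card_image_le
    have l1 := le_card_sdiff (P.image Prod.fst) X
    have l2 := le_card_sdiff (P.image Prod.snd) Y
    obtain ⟨x, hx, y, hy, hxy⟩ := hr (X \ P.image Prod.fst) (Y \ P.image Prod.snd)
      (hXY.mono sdiff_subset sdiff_subset) (by omega) (by omega)
    rw [mem_sdiff] at hx hy
    have hx' : x ∉ Prod.fst '' (P : Set (α × α)) := by
      rw [← coe_image, mem_coe]; exact hx.2
    have hy' : y ∉ Prod.snd '' (P : Set (α × α)) := by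
      rw [← coe_image, mem_coe]; exact hy.2
    have hnot : (x, y) ∉ P := fun h => hx.2 (mem_image_of_mem Prod.fst h)
    refine ⟨insert (x, y) P, by rw [card_insert_of_notMem hnot, hPd], ?_, ?_, ?_⟩
    · intro e he
      rcases mem_insert.1 he with rfl | he
      · exact ⟨hx.1, hy.1, hxy⟩
      · exact hP e he
    · rw [coe_insert, Set.injOn_insert (by simpa using hnot)]
      exact ⟨hfst, hx'⟩
    · rw [coe_insert, Set.injOn_insert (by simpa using hnot)]
      exact ⟨hsnd, hy'⟩

/-- A matching whose edges lie within the fibres of `p` has at most `⌊|K|/2⌋` edges in each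
fibre `K`. -/
lemma card_pairs_le_sum_half {α β : Type*} [Fintype α] [DecidableEq α] [DecidableEq β]
    (p : α → β) {X Y : Finset α} (hXY : Disjoint X Y) (P : Finset (α × α))
    (hP : ∀ e ∈ P, e.1 ∈ X ∧ e.2 ∈ Y ∧ p e.1 = p e.2)
    (hfst : Set.InjOn Prod.fst (P : Set (α × α))) (hsnd : Set.InjOn Prod.snd (P : Set (α × α))) :
    #P ≤ ∑ b ∈ univ.image p, #{v | p v = b} / 2 := by
  rw [card_eq_sum_card_fiberwise (f := fun e => p e.1) (t := univ.image p)
    (fun e _ => by simp)]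
  refine sum_le_sum fun b _ => ?_
  rw [Nat.le_div_iff_mul_le two_pos]
  set F := {e ∈ P | p e.1 = b}
  have hF : ∀ e ∈ F, e ∈ P ∧ p e.1 = b := fun e he => mem_filter.1 he
  have hFP : (F : Set (α × α)) ⊆ P := fun e he => (hF e he).1
  have h1 : #(F.image Prod.fst) = #F := card_image_of_injOn (hfst.mono hFP)
  have h2 : #(F.image Prod.snd) = #F := card_image_of_injOn (hsnd.mono hFP)
  have hd : Disjoint (F.image Prod.fst) (F.image Prod.snd) := by
    refine hXY.mono ?_ ?_ <;> intro v hv <;> obtain ⟨e, he, rfl⟩ := mem_image.1 hv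
    · exact (hP e (hF e he).1).1
    · exact (hP e (hF e he).1).2.1
  calc #F * 2 = #(F.image Prod.fst ∪ F.image Prod.snd) := by
        rw [card_union_of_disjoint hd]; omega
    _ ≤ #{v | p v = b} := card_le_card fun v hv => by
        rw [mem_filter]
        refine ⟨mem_univ _, ?_⟩
        rcases mem_union.1 hv with h | h <;> obtain ⟨e, he, rfl⟩ := mem_image.1 h
        · exact (hF e he).2
        · rw [← (hP e (hF e he).1).2.2]; exact (hF e he).2

variable {α : Type*} [Fintype α] [DecidableEq α] {q k : ℕ} {β : Fin q → Type*}
  [∀ j, DecidableEq (β j)] {p : ∀ j, α → β j} {m : Fin q → ℕ}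

/-- The bound on the number of vertices when one class is large. -/
lemma card_le_of_large_fibre
    (hr : ∀ X Y : Finset α, Disjoint X Y → k < #X → k < #Y →
      ∃ x ∈ X, ∃ y ∈ Y, ∃ j, p j x = p j y)
    (hm : ∀ j, ∑ b ∈ univ.image (p j), #{v | p j v = b} / 2 ≤ m j) {M : ℕ} (hM : ∀ j, m j ≤ M)
    (j : Fin q) (v₀ : α)
    (hbig : Fintype.card α ≤ 2 * #{v | p j v = p j v₀} + (q + 12) * k) :
    Fintype.card α ≤ 1 + M + ∑ j, m j + (q + 13) * k := by
  set K : Finset α := {v | p j v = p j v₀} with hK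
  have hcompl := card_compl_add_card K
  have others : min #K #Kᶜ ≤ ∑ i ∈ univ.erase j, m i + k := by
    by_cases hk : min #K #Kᶜ < k
    · omega
    obtain ⟨P, hPc, hP, hfst, hsnd⟩ := exists_pairs_of_connector hr
      (disjoint_compl_right (a := K)) (min #K #Kᶜ - k) (by omega) (by omega)
    have hcover : P ⊆ (univ.erase j).biUnion fun i => {e ∈ P | p i e.1 = p i e.2} := by
      intro e he
      obtain ⟨h1, h2, i, hi⟩ := hP e he
      simp only [mem_biUnion, mem_erase, mem_univ, and_true, mem_filter]
      refine ⟨i, ?_, he, hi⟩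
      rintro rfl
      simp only [hK, mem_compl, mem_filter, mem_univ, true_and] at h1 h2
      exact h2 (hi ▸ h1)
    have hle : #P ≤ ∑ i ∈ univ.erase j, m i := by
      refine (card_le_card hcover).trans (card_biUnion_le.trans (sum_le_sum fun i _ => ?_))
      refine (card_pairs_le_sum_half (p i) (disjoint_compl_right (a := K)) _ (fun e he => ?_)
        (hfst.mono ?_) (hsnd.mono ?_)).trans (hm i)
      · obtain ⟨he, hi⟩ := mem_filter.1 he
        exact ⟨(hP e he).1, (hP e he).2.1, hi⟩
      · exact fun e he => (mem_filter.1 he).1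
      · exact fun e he => (mem_filter.1 he).1
    omega
  have own : #K / 2 ≤ m j := by
    refine le_trans ?_ (hm j)
    exact single_le_sum (f := fun b => #{v | p j v = b} / 2) (fun _ _ => Nat.zero_le _)
      (mem_image_of_mem (p j) (mem_univ v₀))
  have hsum := add_sum_erase univ m (mem_univ j)
  have := hM j
  have : (q + 13) * k = (q + 12) * k + k := by ring
  omega

/-- The bound on the number of vertices when all classes are small. -/
lemma card_le_of_small_fibres (hq : 1 ≤ q)
    (hr : ∀ X Y : Finset α, Disjoint X Y → k < #X → k < #Y →
      ∃ x ∈ X, ∃ y ∈ Y, ∃ j, p j x = p j y)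
    (hm : ∀ j, ∑ b ∈ univ.image (p j), #{v | p j v = b} / 2 ≤ m j)
    (hsmall : ∀ j v₀, 2 * #{v | p j v = p j v₀} + (q + 12) * k < Fintype.card α) :
    Fintype.card α ≤ ∑ j, m j + 14 * k := by
  set F : Fin q → α → Finset α := fun j v => {w | p j w = p j v} with hF
  have memF : ∀ j v w, w ∈ F j v ↔ p j w = p j v := fun j v w => by simp [hF]
  have selfF : ∀ j v, v ∈ F j v := fun j v => (memF j v v).2 rfl
  have hFsmall : ∀ j v, 2 * #(F j v) + 13 * k < Fintype.card α := fun j v => by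
    have h1 := hsmall j v
    have h2 : 13 * k ≤ (q + 12) * k := Nat.mul_le_mul_right k (by omega)
    change 2 * #{w | p j w = p j v} + 13 * k < _
    omega
  set φ : Fin q → α → ℚ := fun j v => ((#(F j v) / 2 : ℕ) : ℚ) / #(F j v) with hφ
  have Fpos : ∀ j v, (0 : ℚ) < #(F j v) := fun j v => by
    exact_mod_cast card_pos.2 ⟨v, selfF j v⟩
  have φnonneg : ∀ j v, 0 ≤ φ j v := fun j v => by positivity
  have φhalf : ∀ j v, 1 / 2 ≤ φ j v + 1 / (2 * #(F j v)) := fun j v => by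
    have h0 := Fpos j v
    have : (#(F j v) : ℚ) ≤ 2 * (#(F j v) / 2 : ℕ) + 1 := by
      exact_mod_cast (by omega : #(F j v) ≤ 2 * (#(F j v) / 2) + 1)
    have e : φ j v + 1 / (2 * #(F j v)) = (2 * (#(F j v) / 2 : ℕ) + 1) / (2 * #(F j v)) := by
      simp only [hφ]
      field_simp
    rw [e, div_le_div_iff₀ (by norm_num) (by positivity)]
    linarith
  have φthird : ∀ j v, 2 ≤ #(F j v) → 1 / 3 ≤ φ j v := fun j v h => by
    have : (#(F j v) : ℚ) ≤ 3 * (#(F j v) / 2 : ℕ) := by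
      exact_mod_cast (by omega : #(F j v) ≤ 3 * (#(F j v) / 2))
    simp only [hφ]
    rw [div_le_div_iff₀ (by norm_num) (Fpos j v)]
    linarith
  have φsum : ∀ j, ∑ v, φ j v ≤ m j := fun j => by
    refine le_trans (le_of_eq ?_) (Nat.cast_le.2 (hm j))
    rw [← sum_fiberwise_of_maps_to (t := univ.image (p j)) (g := p j) (fun v _ => by simp)]
    push_cast
    refine sum_congr rfl fun b hb => ?_
    obtain ⟨w, -, rfl⟩ := mem_image.1 hb
    rw [sum_congr rfl (g := fun _ => φ j w) fun v hv => by
      have : F j v = F j w := by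
        ext u; rw [memF, memF, (mem_filter.1 hv).2]
      simp only [hφ, this]]
    rw [sum_const, nsmul_eq_mul]
    exact mul_div_cancel₀ _ (Fpos j w).ne'
  set nt : α → Finset (Fin q) := fun v => {j | 2 ≤ #(F j v)} with hnt
  have hshared : ∀ x y, x ≠ y → ∀ j, p j x = p j y → j ∈ nt x ∧ F j x = F j y := by
    intro x y hne j hj
    refine ⟨?_, by ext u; rw [memF, memF, hj]⟩
    simp only [hnt, mem_filter, mem_univ, true_and]
    exact one_lt_card.2 ⟨x, selfF j x, y, (memF j x y).2 hj.symm, hne⟩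
  have hpair : ∀ v, #(nt v) < 3 → ∃ A B : Finset α, v ∈ A ∧ v ∈ B ∧
      2 * #A + 13 * k < Fintype.card α ∧ 2 * #B + 13 * k < Fintype.card α ∧
      (∀ j ∈ nt v, F j v = A ∨ F j v = B) ∧
      1 ≤ ∑ j, φ j v + (1 / (2 * #A) + 1 / (2 * #B)) := by
    intro v hv
    have hone : 2 * #({v} : Finset α) + 13 * k < Fintype.card α := by
      have h1 := hFsmall ⟨0, hq⟩ v
      have h2 : 0 < #(F ⟨0, hq⟩ v) := card_pos.2 ⟨v, selfF _ v⟩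
      rw [card_singleton]
      omega
    have hsub : ∀ s : Finset (Fin q), ∑ j ∈ s, φ j v ≤ ∑ j, φ j v := fun s =>
      sum_le_sum_of_subset_of_nonneg (subset_univ s) fun j _ _ => φnonneg j v
    obtain h | h | h : #(nt v) = 0 ∨ #(nt v) = 1 ∨ #(nt v) = 2 := by omega
    · refine ⟨{v}, {v}, by simp, by simp, hone, hone, ?_, ?_⟩
      · rw [card_eq_zero.1 h]; simp
      · have := hsub ∅
        rw [sum_empty] at this
        rw [card_singleton]
        push_cast
        linarith
    · obtain ⟨i, hi⟩ := card_eq_one.1 h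
      refine ⟨F i v, {v}, selfF i v, by simp, hFsmall i v, hone, ?_, ?_⟩
      · rw [hi]; simp
      · have := hsub {i}
        rw [sum_singleton] at this
        rw [card_singleton]
        push_cast
        linarith [φhalf i v]
    · obtain ⟨i, j, hij, hi⟩ := card_eq_two.1 h
      refine ⟨F i v, F j v, selfF i v, selfF j v, hFsmall i v, hFsmall j v, ?_, ?_⟩
      · rw [hi]; simp
      · have := hsub {i, j}
        rw [sum_pair hij] at this
        linarith [φhalf i v, φhalf j v]
  have hordered : ∀ v, #(nt v) < 3 → ∃ A B : Finset α, v ∈ A ∧ v ∈ B ∧ #B ≤ #A ∧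
      2 * #A + 13 * k < Fintype.card α ∧ (∀ j ∈ nt v, F j v = A ∨ F j v = B) ∧
      1 ≤ ∑ j, φ j v + (1 / (2 * #A) + 1 / (2 * #B)) := by
    intro v hv
    obtain ⟨A, B, hA, hB, hA', hB', hAB, h1⟩ := hpair v hv
    rcases le_total #B #A with h | h
    · exact ⟨A, B, hA, hB, h, hA', hAB, h1⟩
    · exact ⟨B, A, hB, hA, h, hB', fun j hj => (hAB j hj).symm, by linarith⟩
  choose! K L hvK hvL hLK hK hKL hloss using hordered
  set W : Finset α := {v | #(nt v) < 3} with hW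
  have memW : ∀ v ∈ W, #(nt v) < 3 := fun v hv => (mem_filter.1 hv).2
  have key := sum_inv_card_le hr W K L (fun v hv => hvK v (memW v hv))
    (fun v hv => hvL v (memW v hv)) (fun v hv => hLK v (memW v hv))
    (fun v hv => hK v (memW v hv))
    (by
      rintro x hx y ⟨j, hj⟩
      rcases eq_or_ne x y with rfl | hne
      · exact mem_union_left _ (hvK x (memW x hx))
      · have hy : y ∈ F j x := (memF j x y).2 hj.symm
        rcases hKL x (memW x hx) j (hshared x y hne j hj).1 with h | h
        · exact mem_union_left _ (h ▸ hy)
        · exact mem_union_right _ (h ▸ hy))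
    (by
      rintro x hx y hy hne ⟨j, hj⟩
      obtain ⟨h1, h2⟩ := hshared x y hne j hj
      have h3 := hKL x (memW x hx) j h1
      have h4 := hKL y (memW y hy) j (hshared y x hne.symm j hj.symm).1
      rw [← h2] at h4
      rcases h3 with h3 | h3 <;> rcases h4 with h4 | h4 <;> rw [← h3, ← h4] <;> simp)
  have hvertex : ∀ v, (1 : ℚ) ≤ ∑ j, φ j v +
      if #(nt v) < 3 then 1 / (2 * #(K v) : ℚ) + 1 / (2 * #(L v)) else 0 := by
    intro v
    split_ifs with h
    · exact hloss v h
    · have h1 : ∑ j ∈ nt v, (1 / 3 : ℚ) ≤ ∑ j ∈ nt v, φ j v :=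
        sum_le_sum fun j hj => φthird j v (mem_filter.1 hj).2
      have h2 : ∑ j ∈ nt v, φ j v ≤ ∑ j, φ j v :=
        sum_le_sum_of_subset_of_nonneg (subset_univ _) fun j _ _ => φnonneg j v
      have h3 : (3 : ℚ) ≤ #(nt v) := by exact_mod_cast not_lt.1 h
      rw [sum_const, nsmul_eq_mul] at h1
      linarith
  have htotal := sum_le_sum fun v (_ : v ∈ (univ : Finset α)) => hvertex v
  rw [sum_add_distrib, ← sum_filter, sum_comm, sum_const, nsmul_eq_mul, mul_one, card_univ]
    at htotal
  have hφm : ∑ j, ∑ v, φ j v ≤ ∑ j, (m j : ℚ) := sum_le_sum fun j _ => φsum j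
  have : (Fintype.card α : ℚ) ≤ ∑ j, (m j : ℚ) + 14 * k := by linarith
  exact_mod_cast this

/-- A vertex set whose pairs are, up to a connector condition, covered by the classes of `q`
partitions has bounded size in terms of the matchings that fit into the classes. -/
lemma card_le_of_partitions (hq : 1 ≤ q)
    (hr : ∀ X Y : Finset α, Disjoint X Y → k < #X → k < #Y →
      ∃ x ∈ X, ∃ y ∈ Y, ∃ j, p j x = p j y)
    (hm : ∀ j, ∑ b ∈ univ.image (p j), #{v | p j v = b} / 2 ≤ m j) {M : ℕ}
    (hM : ∀ j, m j ≤ M) :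
    Fintype.card α ≤ 1 + M + ∑ j, m j + (q + 13) * k := by
  by_cases h : ∃ j v₀, Fintype.card α ≤ 2 * #{v | p j v = p j v₀} + (q + 12) * k
  · obtain ⟨j, v₀, hbig⟩ := h
    exact card_le_of_large_fibre hr hm hM j v₀ hbig
  · push Not at h
    have h1 := card_le_of_small_fibres hq hr hm h
    have h2 : 14 * k ≤ (q + 13) * k := Nat.mul_le_mul_right k (by omega)
    omega

end Partitions

section TutteBerge

open Finset

/-- The graph obtained from `H` by adding `d` vertices adjacent to all other vertices. -/
def addUniversal {V : Type*} (H : SimpleGraph V) (d : ℕ) : SimpleGraph (V ⊕ Fin d) where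
  Adj x y := x ≠ y ∧ ∀ v w, x = Sum.inl v → y = Sum.inl w → H.Adj v w
  symm := ⟨fun _ _ h => ⟨h.1.symm, fun v w hv hw => (h.2 w v hw hv).symm⟩⟩
  loopless := ⟨fun _ h => h.1 rfl⟩

variable {V : Type*} {H : SimpleGraph V} {d : ℕ}

lemma addUniversal_adj_inl {v w : V} :
    (addUniversal H d).Adj (Sum.inl v) (Sum.inl w) ↔ H.Adj v w :=
  ⟨fun h => h.2 v w rfl rfl, fun h => ⟨fun e => h.ne (Sum.inl_injective e), fun _ _ hv hw => by
    rwa [← Sum.inl_injective hv, ← Sum.inl_injective hw]⟩⟩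

lemma addUniversal_adj_inr {x : V ⊕ Fin d} {i : Fin d} (h : x ≠ Sum.inr i) :
    (addUniversal H d).Adj x (Sum.inr i) :=
  ⟨h, fun _ _ _ hw => by simp at hw⟩

/-- If adding `d` universal vertices produces a perfect matching, then `H` has a matching missing
at most `d` vertices. -/
lemma card_le_of_isPerfectMatching_addUniversal [Fintype V] {m : ℕ}
    (hm : ∀ M : Finset (Sym2 V), IsMatchingSet H M → #M ≤ m)
    {P : (addUniversal H d).Subgraph} (hP : P.IsPerfectMatching) :
    Fintype.card V ≤ 2 * m + d := by
  classical
  set M : Finset (Sym2 V) := {e | e.map Sum.inl ∈ P.edgeSet} with hM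
  have memM : ∀ v w, s(v, w) ∈ M ↔ P.Adj (Sum.inl v) (Sum.inl w) := fun v w => by simp [hM]
  have hmatch : IsMatchingSet H M := by
    refine ⟨fun e he => ?_, fun e he f hf hne v hve hvf => hne ?_⟩
    · induction e with
      | _ v w => exact addUniversal_adj_inl.1 (((memM v w).1 he).adj_sub)
    · obtain ⟨a, rfl⟩ := Sym2.mem_iff_exists.1 hve
      obtain ⟨b, rfl⟩ := Sym2.mem_iff_exists.1 hvf
      rw [memM] at he hf
      rw [Sum.inl_injective (hP.1.eq_of_adj_left he hf)]
  set T : Finset V := {v | ∃ i, P.Adj (Sum.inl v) (Sum.inr i)} with hT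
  have hcover : (univ : Finset V) ⊆ T ∪ M.biUnion Sym2.toFinset := by
    intro v _
    obtain ⟨x, hx, -⟩ := Subgraph.isPerfectMatching_iff.1 hP (Sum.inl v)
    cases x with
    | inl w => exact mem_union_right _ (mem_biUnion.2 ⟨s(v, w), (memM v w).2 hx, by simp⟩)
    | inr i => exact mem_union_left _ (mem_filter.2 ⟨mem_univ _, i, hx⟩)
  have hTd : #T ≤ d := by
    have hsub : T ⊆ univ.biUnion fun i => {v | P.Adj (Sum.inl v) (Sum.inr i)} := fun v hv => by
      simpa [hT] using hv
    refine (card_le_card hsub).trans ((card_biUnion_le_card_mul _ _ 1 fun i _ => ?_).trans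
      (by simp))
    refine card_le_one.2 fun v hv w hw => ?_
    exact Sum.inl_injective (hP.1.eq_of_adj_right (mem_filter.1 hv).2 (mem_filter.1 hw).2)
  have hM2 : #(M.biUnion Sym2.toFinset) ≤ #M * 2 := card_biUnion_le_card_mul _ _ _ fun e _ => by
    rw [Sym2.card_toFinset]
    split_ifs <;> omega
  have h1 := card_le_card hcover
  have h2 := card_union_le T (M.biUnion Sym2.toFinset)
  have h3 := hm M hmatch
  rw [card_univ] at h1
  omega

/-- The **Tutte–Berge formula**: deleting a suitable set `A` from a graph without matchings of more
than `m` edges leaves components that certify this bound. -/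
lemma exists_tutteBerge_certificate.{u} {V : Type u} [Fintype V] [DecidableEq V]
    (H : SimpleGraph V) (m : ℕ)
    (hm : ∀ M : Finset (Sym2 V), IsMatchingSet H M → #M ≤ m) :
    ∃ (β : Type u) (_ : DecidableEq β) (A : Finset V) (p : V → β),
      (∀ v w, H.Adj v w → v ∉ A → w ∉ A → p v = p w) ∧
        #A + ∑ b ∈ Aᶜ.image p, #{v ∈ Aᶜ | p v = b} / 2 ≤ m := by
  classical
  by_cases hn : Fintype.card V ≤ 2 * m + 1
  · refine ⟨PUnit, inferInstance, ∅, fun _ => PUnit.unit, fun _ _ _ _ _ => rfl, ?_⟩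
    refine (add_le_add le_rfl (sum_le_sum_of_subset (subset_univ _))).trans ?_
    simp
    omega
  set d := Fintype.card V - 2 * m - 2 with hd
  have hno : ¬ ∃ P : (addUniversal H d).Subgraph, P.IsPerfectMatching := by
    rintro ⟨P, hP⟩
    have := card_le_of_isPerfectMatching_addUniversal hm hP
    omega
  rw [tutte] at hno
  push Not at hno
  obtain ⟨u, hu⟩ := hno
  rw [IsTutteViolator] at hu
  set Q := ((⊤ : (addUniversal H d).Subgraph).deleteVerts u).coe with hQ
  have hverts : ∀ x, x ∈ ((⊤ : (addUniversal H d).Subgraph).deleteVerts u).verts ↔ x ∉ u :=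
    fun x => by simp
  have hadj : ∀ x y : ((⊤ : (addUniversal H d).Subgraph).deleteVerts u).verts,
      (addUniversal H d).Adj x y → Q.Adj x y := fun x y h => by
    rw [hQ, Subgraph.coe_adj, Subgraph.deleteVerts_adj]
    exact ⟨trivial, (hverts _).1 x.2, trivial, (hverts _).1 y.2, h⟩
  have hparity : u.ncard + 2 ≤ Q.oddComponents.ncard := by
    have h1 := odd_ncard_oddComponents Q
    have h2 : Nat.card ((⊤ : (addUniversal H d).Subgraph).deleteVerts u).verts + u.ncard =
        Fintype.card V + d := by
      have h3 : ((⊤ : (addUniversal H d).Subgraph).deleteVerts u).verts = uᶜ := by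
        ext x; simp
      rw [h3, Nat.card_coe_set_eq, add_comm, Set.ncard_add_ncard_compl]
      simp
    rw [Nat.odd_iff, Nat.odd_iff] at h1
    omega
  have huniv : ∀ i, Sum.inr i ∈ u := by
    intro i
    by_contra hi
    have hreach : ∀ x, Q.Reachable x ⟨Sum.inr i, (hverts _).2 hi⟩ := fun x => by
      by_cases hx : x.1 = Sum.inr i
      · rw [show x = ⟨Sum.inr i, (hverts _).2 hi⟩ from Subtype.ext hx]
      · exact (hadj x ⟨Sum.inr i, (hverts _).2 hi⟩ (addUniversal_adj_inr hx)).reachable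
    have hsub : Q.oddComponents.Subsingleton := fun c _ c' _ => by
      induction c using ConnectedComponent.ind with | _ x =>
      induction c' using ConnectedComponent.ind with | _ y =>
      exact ConnectedComponent.sound ((hreach x).trans (hreach y).symm)
    have := Set.ncard_le_one_iff_subsingleton.2 hsub
    omega
  set A : Finset V := {v | Sum.inl v ∈ u} with hA
  have memA : ∀ v, v ∉ A ↔ Sum.inl v ∉ u := fun v => by simp [hA]
  have hucard : u.ncard = #A + d := by
    have : u = Sum.inl '' (A : Set V) ∪ Set.range Sum.inr := by
      ext x
      cases x with
      | inl v => simp [hA]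
      | inr i => simp [huniv i]
    rw [this, Set.ncard_union_eq, Set.ncard_image_of_injective _ Sum.inl_injective,
      Set.ncard_coe_finset, ← Set.image_univ, Set.ncard_image_of_injective _ Sum.inr_injective]
    · simp
    · rw [Set.disjoint_left]
      rintro _ ⟨v, -, rfl⟩ ⟨i, hi⟩
      simp at hi
  set p : V → Option Q.ConnectedComponent := fun v =>
    if h : Sum.inl v ∉ u then some (Q.connectedComponentMk ⟨Sum.inl v, (hverts _).2 h⟩) else none
    with hp
  have p_eq : ∀ v (h : Sum.inl v ∉ u),
      p v = some (Q.connectedComponentMk ⟨Sum.inl v, (hverts _).2 h⟩) := fun v h => dif_pos h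
  refine ⟨_, inferInstance, A, p, fun v w hvw hv hw => ?_, ?_⟩
  · rw [memA] at hv hw
    rw [p_eq v hv, p_eq w hw, ConnectedComponent.sound]
    exact (hadj ⟨_, (hverts _).2 hv⟩ ⟨_, (hverts _).2 hw⟩ (addUniversal_adj_inl.2 hvw)).reachable
  have hsupp : ∀ c : Q.ConnectedComponent, #{v ∈ Aᶜ | p v = some c} = c.supp.ncard := by
    intro c
    rw [← Set.ncard_coe_finset, ← Set.ncard_image_of_injective _ (Sum.inl_injective (β := Fin d)),
      ← Set.ncard_image_of_injective c.supp Subtype.val_injective]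
    congr 1
    ext x
    constructor
    · rintro ⟨v, hv, rfl⟩
      obtain ⟨hvA, hvc⟩ := mem_filter.1 (mem_coe.1 hv)
      have hvu := (memA v).1 (mem_compl.1 hvA)
      rw [p_eq v hvu, Option.some_inj] at hvc
      exact ⟨⟨Sum.inl v, (hverts _).2 hvu⟩, hvc, rfl⟩
    · rintro ⟨⟨x, hx⟩, hxc, rfl⟩
      cases x with
      | inl v =>
        have hvu := (hverts _).1 hx
        refine ⟨v, ?_, rfl⟩
        rw [mem_coe, mem_filter, mem_compl, memA, p_eq v hvu]
        exact ⟨hvu, congrArg some hxc⟩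
      | inr i => exact absurd (huniv i) ((hverts _).1 hx)
  have hodd : Q.oddComponents.ncard ≤ #{b ∈ Aᶜ.image p | Odd #{v ∈ Aᶜ | p v = b}} := by
    rw [← Set.ncard_image_of_injective _ (Option.some_injective _), ← Set.ncard_coe_finset]
    refine Set.ncard_le_ncard ?_ (finite_toSet _)
    rintro _ ⟨c, hc, rfl⟩
    rw [mem_coe, mem_filter, hsupp]
    refine ⟨?_, hc⟩
    have hpos : 0 < #{v ∈ Aᶜ | p v = some c} := by
      rw [hsupp]
      exact Odd.pos hc
    obtain ⟨v, hv⟩ := card_pos.1 hpos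
    obtain ⟨hvA, hvc⟩ := mem_filter.1 hv
    exact mem_image.2 ⟨v, hvA, hvc⟩
  have hsum : ∑ b ∈ Aᶜ.image p, #{v ∈ Aᶜ | p v = b} = #Aᶜ :=
    (card_eq_sum_card_image p Aᶜ).symm
  have hhalf : 2 * ∑ b ∈ Aᶜ.image p, #{v ∈ Aᶜ | p v = b} / 2 +
      #{b ∈ Aᶜ.image p | Odd #{v ∈ Aᶜ | p v = b}} = #Aᶜ := by
    rw [← hsum, mul_sum, card_filter, ← sum_add_distrib]
    refine sum_congr rfl fun b _ => ?_
    split_ifs with h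
    · rw [Nat.odd_iff] at h; omega
    · rw [Nat.odd_iff] at h; omega
  have hcompl := card_compl_add_card A
  omega

end TutteBerge

section Colouring

open Finset

/-- The graph formed by the edges of colour `j`. -/
def colourGraph {V : Type*} {q : ℕ} (G : SimpleGraph V) (c : Sym2 V → Fin q) (j : Fin q) :
    SimpleGraph V where
  Adj v w := G.Adj v w ∧ c s(v, w) = j
  symm := ⟨fun _ _ h => ⟨h.1.symm, Sym2.eq_swap ▸ h.2⟩⟩
  loopless := ⟨fun _ h => h.1.ne rfl⟩

/-- A colour without a monochromatic matching of size `t` has no larger matching either. -/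
lemma card_lt_of_isMatchingSet_colourGraph {V : Type*} {q t : ℕ} {G : SimpleGraph V}
    {c : Sym2 V → Fin q} {j : Fin q}
    (h : ¬ ∃ M : Finset (Sym2 V), IsMatchingSet G M ∧ #M = t ∧ ∀ e ∈ M, c e = j)
    {M : Finset (Sym2 V)} (hM : IsMatchingSet (colourGraph G c j) M) : #M < t := by
  by_contra! hle
  obtain ⟨N, hNM, hN⟩ := exists_subset_card_eq hle
  have hcol : ∀ e ∈ N, e ∈ G.edgeSet ∧ c e = j := fun e he => by
    have := hM.1 e (hNM he)
    induction e with
    | _ v w => exact this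
  exact h ⟨N, ⟨fun e he => (hcol e he).1, fun e he f hf => hM.2 e (hNM he) f (hNM hf)⟩, hN,
    fun e he => (hcol e he).2⟩

/-- The number of vertices of a `(k + 1)`-connector is bounded by the matching numbers of the
colours of any edge colouring. -/
lemma card_le_of_isConnector.{u} {V : Type u} [Fintype V] {q k : ℕ} (hq : 1 ≤ q)
    {G : SimpleGraph V} (hG : IsConnector G (k + 1)) (c : Sym2 V → Fin q) (m : Fin q → ℕ)
    (hm : ∀ j M, IsMatchingSet (colourGraph G c j) M → #M ≤ m j) {M : ℕ} (hM : ∀ j, m j ≤ M) :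
    Fintype.card V ≤ 1 + M + ∑ j, m j + (q + 13) * k := by
  classical
  choose β hβ A p hp hA using
    fun j => exists_tutteBerge_certificate (colourGraph G c j) (m j) (hm j)
  set S : Finset V := univ.biUnion A with hS
  have hSA : ∀ v ∉ S, ∀ j, v ∉ A j := fun v hv j hj =>
    hv (mem_biUnion.2 ⟨j, mem_univ j, hj⟩)
  have hbound := card_le_of_partitions (α := {v // v ∉ S}) (k := k) (M := M)
    (p := fun j v => p j v) (m := fun j => m j - #(A j)) hq
    (by
      intro X Y hXY hX hY
      obtain ⟨x, hx, y, hy, hxy⟩ := hG (Subtype.val '' (X : Set {v // v ∉ S}))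
        (Subtype.val '' (Y : Set {v // v ∉ S}))
        ((Set.disjoint_image_iff Subtype.val_injective).2 (disjoint_coe.2 hXY))
        (by rwa [Set.ncard_image_of_injective _ Subtype.val_injective, Set.ncard_coe_finset])
        (by rwa [Set.ncard_image_of_injective _ Subtype.val_injective, Set.ncard_coe_finset])
      obtain ⟨x, hx, rfl⟩ := hx
      obtain ⟨y, hy, rfl⟩ := hy
      exact ⟨x, hx, y, hy, c s(x, y), hp _ x y ⟨hxy, rfl⟩ (hSA x x.2 _) (hSA y y.2 _)⟩)
    (by
      intro j
      have hle : ∑ b ∈ univ.image (fun v : {v // v ∉ S} => p j v),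
          #{v : {v // v ∉ S} | p j v = b} / 2 ≤
            ∑ b ∈ (A j)ᶜ.image (p j), #{v ∈ (A j)ᶜ | p j v = b} / 2 := by
        refine (sum_le_sum fun b _ => Nat.div_le_div_right ?_).trans
          (sum_le_sum_of_subset fun b hb => ?_)
        · refine card_le_card_of_injOn Subtype.val (fun v hv => ?_) Subtype.val_injective.injOn
          rw [mem_coe, mem_filter] at hv ⊢
          exact ⟨mem_compl.2 (hSA v v.2 j), hv.2⟩
        · obtain ⟨v, -, rfl⟩ := mem_image.1 hb
          exact mem_image_of_mem _ (mem_compl.2 (hSA v v.2 j))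
      have := hA j
      omega)
    (fun j => (Nat.sub_le _ _).trans (hM j))
  have hcard : Fintype.card {v // v ∉ S} + #S = Fintype.card V := by
    rw [Fintype.card_subtype_compl, Fintype.card_coe]
    exact Nat.sub_add_cancel (card_le_univ S)
  have hScard : #S ≤ ∑ j, #(A j) := card_biUnion_le
  have hsum : ∑ j, (m j - #(A j)) + ∑ j, #(A j) = ∑ j, m j := by
    rw [← sum_add_distrib]
    exact sum_congr rfl fun j _ => Nat.sub_add_cancel (by have := hA j; omega)
  omega

end Colouring

/-- **Lemma 3.10.** Let `q, s ≥ 1` and let `z ∈ ℕ^q` satisfy `min_j z_j ≥ s - 1` and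
`‖z‖₁ + min_j z_j ≥ (q+13)(s-1)`.  For all `t ∈ ℕ₊^q` and `n ≥ ‖t‖_∞ + Λ_t + 1`,
every `n`-vertex `s`-connector `G` satisfies `G → (t - z)⁺ K₂`.
(The condition on the minimum of `z` is phrased via minimisers, which exist as `q ≥ 1`;
truncated subtraction on `ℕ` realises `(t - z)⁺`.) -/
theorem arrows_truncated_sub {q s : ℕ} (hq : 1 ≤ q) (hs : 1 ≤ s)
    (z : Fin q → ℕ)
    (hz1 : ∀ j, s - 1 ≤ z j)
    (hz2 : ∀ j, (∀ i, z j ≤ z i) → (q + 13) * (s - 1) ≤ (∑ i, z i) + z j)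
    (t : Fin q → ℕ) (ht : ∀ j, 1 ≤ t j)
    {V : Type*} [Fintype V]
    (hn : Finset.univ.sup t + (∑ j, (t j - 1)) + 1 ≤ Fintype.card V)
    (G : SimpleGraph V) (hG : IsConnector G s) :
    ArrowsMatch G (fun j => t j - z j) := by
  intro c
  by_contra! hno
  have hzt : ∀ j, z j < t j := fun j => by
    by_contra! hle
    obtain ⟨e, he, -⟩ := hno j ∅ ⟨by simp, by simp⟩ (by simp; omega)
    simp at he
  have hm : ∀ j M, IsMatchingSet (colourGraph G c j) M → M.card ≤ t j - z j - 1 := by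
    intro j M hM
    have hlt : M.card < t j - z j := card_lt_of_isMatchingSet_colourGraph
      (by rintro ⟨N, h1, h2, h3⟩
          obtain ⟨e, he, hne⟩ := hno j N h1 h2
          exact hne (h3 e he)) hM
    omega
  have hne : (Finset.univ : Finset (Fin q)).Nonempty := ⟨⟨0, hq⟩, Finset.mem_univ _⟩
  obtain ⟨jmax, -, hmax⟩ := Finset.exists_max_image Finset.univ (fun j => t j - z j - 1) hne
  obtain ⟨jmin, -, hmin⟩ := Finset.exists_min_image Finset.univ z hne
  obtain ⟨k, rfl⟩ : ∃ k, s = k + 1 := ⟨s - 1, by omega⟩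
  have hbound := card_le_of_isConnector hq hG c _ hm (fun j => hmax j (Finset.mem_univ j))
  have hz := hz2 jmin fun i => hmin i (Finset.mem_univ i)
  have hsum : ∑ j, (t j - 1) = ∑ j, (t j - z j - 1) + ∑ j, z j := by
    rw [← Finset.sum_add_distrib]
    exact Finset.sum_congr rfl fun j _ => by have := hzt j; omega
  have htmax : t jmax ≤ Finset.univ.sup t := Finset.le_sup (Finset.mem_univ jmax)
  have := hmin jmax (Finset.mem_univ jmax)
  have := hzt jmax
  rw [Nat.add_sub_cancel] at hz
  omega
end

section
/- Let H = (V,F) be an s-connector and let G = (V,E) be a spanning subgraph of H. Then there exists a graph G' = (V,E') with E ⊆ E' ⊆ F such that ν(G') = ν(G), the graph H has no edges between C' and D' where GE(G') = (C',A',D'), and either |C'| < s or |C'| > |V| − 2s. -/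
open SimpleGraph

variable {V : Type*}

section MatchingSets

variable {G : SimpleGraph V}

lemma IsMatchingSet.mono {G' : SimpleGraph V} {M : Finset (Sym2 V)} (hM : IsMatchingSet G M)
    (h : G ≤ G') : IsMatchingSet G' M :=
  ⟨fun e he => edgeSet_mono h (hM.1 e he), hM.2⟩

lemma IsMatchingSet.subset {M N : Finset (Sym2 V)} (hM : IsMatchingSet G M) (h : N ⊆ M) :
    IsMatchingSet G N :=
  ⟨fun e he => hM.1 e (h he), fun e he f hf => hM.2 e (h he) f (h hf)⟩

lemma IsMatchingSet.eq_of_mem {M : Finset (Sym2 V)} (hM : IsMatchingSet G M) {e f : Sym2 V}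
    (he : e ∈ M) (hf : f ∈ M) {v : V} (hve : v ∈ e) (hvf : v ∈ f) : e = f := by
  by_contra hne
  exact hM.2 e he f hf hne v hve hvf

lemma IsMatchingSet.insert [DecidableEq V] {M : Finset (Sym2 V)} (hM : IsMatchingSet G M)
    {a d : V} (had : G.Adj a d) (ha : ∀ e ∈ M, a ∉ e) (hd : ∀ e ∈ M, d ∉ e) :
    IsMatchingSet G (insert s(a, d) M) := by
  refine ⟨?_, ?_⟩
  · intro e he
    rcases Finset.mem_insert.1 he with rfl | he
    · exact had
    · exact hM.1 e he
  · intro e he f hf hne v hve hvf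
    rcases Finset.mem_insert.1 he with rfl | heM <;>
      rcases Finset.mem_insert.1 hf with rfl | hfM
    · exact hne rfl
    · rcases Sym2.mem_iff.1 hve with rfl | rfl
      · exact ha f hfM hvf
      · exact hd f hfM hvf
    · rcases Sym2.mem_iff.1 hvf with rfl | rfl
      · exact ha e heM hve
      · exact hd e heM hve
    · exact hM.2 e heM f hfM hne v hve hvf

/-- The involution exchanging the endpoints of every edge of a matching. -/
lemma IsMatchingSet.exists_mate {M : Finset (Sym2 V)} (hM : IsMatchingSet G M) :
    ∃ f : V → V, Function.Involutive f ∧ (∀ e ∈ M, ∀ v ∈ e, e = s(v, f v)) ∧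
      ∀ v, (∀ e ∈ M, v ∉ e) → f v = v := by
  have key : ∀ v, ∃ w, s(v, w) ∈ M ∨ (w = v ∧ ∀ e ∈ M, v ∉ e) := by
    intro v
    by_cases h : ∃ e ∈ M, v ∈ e
    · obtain ⟨e, he, hv⟩ := h
      obtain ⟨w, rfl⟩ := Sym2.mem_iff_exists.1 hv
      exact ⟨w, Or.inl he⟩
    · push Not at h
      exact ⟨v, Or.inr ⟨rfl, h⟩⟩
  choose f hf using key
  refine ⟨f, fun v => ?_, fun e he v hv => ?_, fun v hv => ?_⟩
  · rcases hf v with h | h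
    · rcases hf (f v) with h' | h'
      · have := hM.eq_of_mem h h' (Sym2.mem_mk_right _ _) (Sym2.mem_mk_left _ _)
        rw [Sym2.eq_swap] at this
        exact (Sym2.congr_right.1 this).symm
      · exact absurd (Sym2.mem_mk_right _ _) (h'.2 _ h)
    · rw [h.1, h.1]
  · rcases hf v with h | h
    · exact hM.eq_of_mem he h hv (Sym2.mem_mk_left _ _)
    · exact absurd hv (h.2 e he)
  · rcases hf v with h | h
    · exact absurd (Sym2.mem_mk_left _ _) (hv _ h)
    · exact h.1

end MatchingSets

section Exchange

/-- No edge of `M` leaves `O`. -/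
def NoCrossing (M : Finset (Sym2 V)) (O : Set V) : Prop :=
  ∀ e ∈ M, (∀ v ∈ e, v ∈ O) ∨ ∀ v ∈ e, v ∉ O

open Classical in
/-- The edges of `M` inside `O` together with the edges of `N` outside `O`. -/
noncomputable def splice (M N : Finset (Sym2 V)) (O : Set V) : Finset (Sym2 V) :=
  M.filter (fun e => ∀ v ∈ e, v ∈ O) ∪ N.filter (fun e => ¬ ∀ v ∈ e, v ∈ O)

lemma mem_splice {M N : Finset (Sym2 V)} {O : Set V} (hN : NoCrossing N O) {e : Sym2 V} :
    e ∈ splice M N O ↔ (e ∈ M ∧ ∀ v ∈ e, v ∈ O) ∨ (e ∈ N ∧ ∀ v ∈ e, v ∉ O) := by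
  classical
  have hne : ∃ v, v ∈ e := by
    induction e with
    | h x y => exact ⟨x, Sym2.mem_mk_left _ _⟩
  simp only [splice, Finset.mem_union, Finset.mem_filter]
  refine or_congr Iff.rfl (and_congr_right fun he => ⟨(hN e he).resolve_left, fun h h' => ?_⟩)
  obtain ⟨v, hv⟩ := hne
  exact h v hv (h' v hv)

lemma IsMatchingSet.splice {G : SimpleGraph V} {M N : Finset (Sym2 V)} {O : Set V}
    (hM : IsMatchingSet G M) (hN : IsMatchingSet G N) (hNO : NoCrossing N O) :
    IsMatchingSet G (splice M N O) := by
  refine ⟨fun e he => ?_, fun e he f hf hne v hve hvf => ?_⟩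
  · rcases (mem_splice hNO).1 he with h | h
    · exact hM.1 e h.1
    · exact hN.1 e h.1
  · rcases (mem_splice hNO).1 he with h | h <;> rcases (mem_splice hNO).1 hf with h' | h'
    · exact hM.2 e h.1 f h'.1 hne v hve hvf
    · exact h'.2 v hvf (h.2 v hve)
    · exact h.2 v hve (h'.2 v hvf)
    · exact hN.2 e h.1 f h'.1 hne v hve hvf

lemma card_splice_add_card_splice {M N : Finset (Sym2 V)} {O : Set V} :
    (splice M N O).card + (splice N M O).card = M.card + N.card := by
  classical
  have key : ∀ M N : Finset (Sym2 V), (splice M N O).card =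
      (M.filter (fun e => ∀ v ∈ e, v ∈ O)).card +
        (N.filter (fun e => ¬ ∀ v ∈ e, v ∈ O)).card := by
    intro M N
    refine Finset.card_union_of_disjoint (Finset.disjoint_left.2 fun e he he' => ?_)
    exact (Finset.mem_filter.1 he').2 (Finset.mem_filter.1 he).2
  have h₁ := M.card_filter_add_card_filter_not (fun e => ∀ v ∈ e, v ∈ O)
  have h₂ := N.card_filter_add_card_filter_not (fun e => ∀ v ∈ e, v ∈ O)
  rw [key, key]
  omega

lemma notMem_splice_of_mem {M N : Finset (Sym2 V)} {O : Set V} (hNO : NoCrossing N O) {v : V}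
    (hv : v ∈ O) (h : ∀ e ∈ M, v ∉ e) : ∀ e ∈ splice M N O, v ∉ e := by
  intro e he hve
  rcases (mem_splice hNO).1 he with h' | h'
  · exact h e h'.1 hve
  · exact h'.2 v hve hv

lemma notMem_splice_of_notMem {M N : Finset (Sym2 V)} {O : Set V} (hNO : NoCrossing N O) {v : V}
    (hv : v ∉ O) (h : ∀ e ∈ N, v ∉ e) : ∀ e ∈ splice M N O, v ∉ e := by
  intro e he hve
  rcases (mem_splice hNO).1 he with h' | h'
  · exact hv (h'.2 v hve)
  · exact h e h'.1 hve

lemma noCrossing_of_mate {M : Finset (Sym2 V)} {O : Set V} {f : V → V}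
    (hM : ∀ e ∈ M, ∀ v ∈ e, e = s(v, f v))
    (hO : ∀ v ∈ O, f v ∈ O) : NoCrossing M O := by
  intro e he
  by_cases h : ∃ v ∈ e, v ∈ O
  · obtain ⟨v, hve, hv⟩ := h
    left
    intro w hw
    rw [hM e he v hve] at hw
    rcases Sym2.mem_iff.1 hw with rfl | rfl
    · exact hv
    · exact hO v hv
  · push Not at h
    exact Or.inr h

/-- Let `f`, `g` be involutions and let `b` be a fixed point of `f`. The orbit of `b` under
`f` and `g` cannot contain both a second fixed point of `f` and a fixed point of `g`. -/
lemma exists_invariant_of_involutive {f g : V → V} (hf : Function.Involutive f)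
    (hg : Function.Involutive g) {b : V} (hb : f b = b) :
    ∃ O : Set V, b ∈ O ∧ (∀ v ∈ O, f v ∈ O) ∧ (∀ v ∈ O, g v ∈ O) ∧
      ∀ a ∈ O, ∀ d ∈ O, f a = a → g d = d → a = b := by
  set F : Equiv.Perm V := hf.toPerm
  set K : Equiv.Perm V := hg.toPerm
  set T : Equiv.Perm V := F * K with hT
  have hFF : F * F = 1 := Equiv.ext hf
  have hKK : K * K = 1 := Equiv.ext hg
  have hFi : F⁻¹ = F := inv_eq_of_mul_eq_one_left hFF
  have hKi : K⁻¹ = K := inv_eq_of_mul_eq_one_left hKK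
  have hFb : F b = b := hb
  have hconj : F * T * F⁻¹ = T⁻¹ := by
    rw [hT, mul_inv_rev, hFi, hKi, ← mul_assoc, hFF, one_mul]
  have hFT : ∀ k : ℤ, F ((T ^ k) b) = (T ^ (-k)) b := by
    intro k
    have h : F * T ^ k = T ^ (-k) * F := by
      rw [zpow_neg, ← inv_zpow, ← hconj, conj_zpow, inv_mul_cancel_right]
    have h' := congrArg (fun p : Equiv.Perm V => p b) h
    simpa [Equiv.Perm.mul_apply, hFb] using h'
  have hKT : ∀ k : ℤ, K ((T ^ k) b) = (T ^ (-(k + 1))) b := by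
    intro k
    have h : K = F * T := by rw [hT, ← mul_assoc, hFF, one_mul]
    rw [← hFT, add_comm, zpow_add, zpow_one]
    conv_lhs => rw [h]
    rfl
  refine ⟨{x | ∃ k : ℤ, (T ^ k) b = x}, ⟨0, rfl⟩, ?_, ?_, ?_⟩
  · rintro _ ⟨k, rfl⟩
    exact ⟨-k, (hFT k).symm⟩
  · rintro _ ⟨k, rfl⟩
    exact ⟨-(k + 1), (hKT k).symm⟩
  · rintro _ ⟨i, rfl⟩ _ ⟨j, rfl⟩ ha hd
    have key : ∀ k l : ℤ, (T ^ k) b = (T ^ l) b → T ^ (k - l) ∈ MulAction.stabilizer _ b := by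
      intro k l h
      rw [MulAction.mem_stabilizer_iff, Equiv.Perm.smul_def, sub_eq_neg_add, zpow_add,
        Equiv.Perm.mul_apply, h, ← Equiv.Perm.mul_apply, ← zpow_add, neg_add_cancel]
      rfl
    have h₁ := Subgroup.zpow_mem _ (key _ _ ((hFT i).symm.trans ha)) (-j)
    have h₂ := Subgroup.zpow_mem _ (key _ _ ((hKT j).symm.trans hd)) i
    have h₃ := Subgroup.mul_mem _ h₁ h₂
    rw [← zpow_mul, ← zpow_mul, ← zpow_add,
      show (-i - i) * -j + (-(j + 1) - j) * i = -i by ring, zpow_neg, inv_mem_iff] at h₃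
    exact h₃

end Exchange

section GallaiEdmonds

variable [Fintype V] {G : SimpleGraph V}

lemma bddAbove_card_isMatchingSet (G : SimpleGraph V) :
    BddAbove {n | ∃ M : Finset (Sym2 V), IsMatchingSet G M ∧ M.card = n} := by
  classical
  refine ⟨Fintype.card (Sym2 V), ?_⟩
  rintro _ ⟨M, -, rfl⟩
  exact Finset.card_le_univ M

lemma IsMatchingSet.card_le_matchingNumber {M : Finset (Sym2 V)} (hM : IsMatchingSet G M) :
    M.card ≤ matchingNumber G :=
  le_csSup (bddAbove_card_isMatchingSet G) ⟨M, hM, rfl⟩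

lemma exists_isMatchingSet_card_eq_matchingNumber (G : SimpleGraph V) :
    ∃ M : Finset (Sym2 V), IsMatchingSet G M ∧ M.card = matchingNumber G :=
  Nat.sSup_mem (s := {n | ∃ M : Finset (Sym2 V), IsMatchingSet G M ∧ M.card = n})
    ⟨0, ∅, ⟨by simp, by simp⟩, rfl⟩ (bddAbove_card_isMatchingSet G)

lemma matchingNumber_mono {G' : SimpleGraph V} (h : G ≤ G') :
    matchingNumber G ≤ matchingNumber G' := by
  obtain ⟨M, hM, hc⟩ := exists_isMatchingSet_card_eq_matchingNumber G
  exact hc ▸ (hM.mono h).card_le_matchingNumber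

lemma IsMatchingSet.mem_geD {M : Finset (Sym2 V)} (hM : IsMatchingSet G M)
    (hc : matchingNumber G ≤ M.card) {v : V} (hv : ∀ e ∈ M, v ∉ e) : v ∈ geD G :=
  ⟨M, hM, le_antisymm hM.card_le_matchingNumber hc, hv⟩

/-- A maximum matching matches every vertex of `A` to a vertex of `D`. -/
lemma mem_geD_of_mem_geA_of_mem {M : Finset (Sym2 V)} (hM : IsMatchingSet G M)
    (hc : M.card = matchingNumber G) {a b : V} (ha : a ∈ geA G) (hab : s(a, b) ∈ M) :
    b ∈ geD G := by
  classical
  by_contra hb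
  obtain ⟨haD, d, hd, had⟩ := ha
  obtain ⟨N, hN, hNc, hNd⟩ := id hd
  have hL : IsMatchingSet G (M.erase s(a, b)) := hM.subset (Finset.erase_subset _ _)
  have hLc : (M.erase s(a, b)).card + 1 = matchingNumber G := by
    rw [Finset.card_erase_add_one hab, hc]
  have hmiss : ∀ v ∈ s(a, b), ∀ e ∈ M.erase s(a, b), v ∉ e := fun v hv e he =>
    hM.2 _ hab e (Finset.mem_of_mem_erase he) (Finset.ne_of_mem_erase he).symm v hv
  have hLa := hmiss a (Sym2.mem_mk_left _ _)
  have hLb := hmiss b (Sym2.mem_mk_right _ _)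
  have hne : a ≠ b := (hM.1 _ hab : G.Adj a b).ne
  generalize M.erase s(a, b) = L at hL hLc hLa hLb
  obtain ⟨f, hf, hfL, hfix⟩ := hL.exists_mate
  obtain ⟨g, hg, hgN, hgfix⟩ := hN.exists_mate
  obtain ⟨O, hbO, hfO, hgO, hO⟩ := exists_invariant_of_involutive hf hg (hfix b hLb)
  have hLO := noCrossing_of_mate hfL hfO
  have hNO := noCrossing_of_mate hgN hgO
  have hcard := card_splice_add_card_splice (M := L) (N := N) (O := O)
  have hLN := hL.splice hN hNO
  have hNL := hN.splice hL hLO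
  have hbLN := notMem_splice_of_mem hNO hbO hLb
  by_cases haO : a ∈ O
  · have hdO : d ∉ O := fun hdO => hne (hO a haO d hdO (hfix a hLa) (hgfix d hNd))
    have haLN := notMem_splice_of_mem hNO haO hLa
    have hdLN := notMem_splice_of_notMem (M := L) hNO hdO hNd
    have hle := hNL.card_le_matchingNumber
    refine hb ((hLN.insert had haLN hdLN).mem_geD ?_ ?_)
    · rw [Finset.card_insert_of_notMem fun h => haLN _ h (Sym2.mem_mk_left _ _)]
      omega
    · intro e he hbe
      rcases Finset.mem_insert.1 he with rfl | he
      · rcases Sym2.mem_iff.1 hbe with rfl | rfl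
        · exact hne rfl
        · exact hb hd
      · exact hbLN e he hbe
  · have haNL := notMem_splice_of_notMem (M := N) hLO haO hLa
    rcases le_or_gt (matchingNumber G) (splice L N O).card with h | h
    · exact hb (hLN.mem_geD h hbLN)
    · exact haD (hNL.mem_geD (by omega) haNL)

lemma ncard_geA_le_ncard_geD (G : SimpleGraph V) : (geA G).ncard ≤ (geD G).ncard := by
  obtain ⟨M, hM, hc⟩ := exists_isMatchingSet_card_eq_matchingNumber G
  obtain ⟨f, hf, hfM, -⟩ := hM.exists_mate
  refine Set.ncard_le_ncard_of_injOn f (fun a ha => ?_) hf.injective.injOn (Set.toFinite _)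
  have hcov : ∃ e ∈ M, a ∈ e := by
    by_contra! h
    exact ha.1 ⟨M, hM, hc, h⟩
  obtain ⟨e, he, hae⟩ := hcov
  exact mem_geD_of_mem_geA_of_mem hM hc ha (hfM e he a hae ▸ he)

lemma card_le_ncard_geC_add_ncard_geA_add_ncard_geD (G : SimpleGraph V) :
    Fintype.card V ≤ (geC G).ncard + (geA G).ncard + (geD G).ncard := by
  have hcover : (Set.univ : Set V) = geC G ∪ geA G ∪ geD G := by
    ext v
    simp only [geC, Set.mem_univ, Set.mem_union, Set.mem_ofPred_eq, true_iff]
    tauto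
  have h₁ := Set.ncard_union_le (geC G ∪ geA G) (geD G)
  have h₂ := Set.ncard_union_le (geC G) (geA G)
  rw [← hcover, Set.ncard_univ, Nat.card_eq_fintype_card] at h₁
  omega

/-- Adding an edge that increases the matching number requires inessential endpoints. -/
lemma mem_geD_of_matchingNumber_lt {x y : V}
    (h : matchingNumber G < matchingNumber (G ⊔ edge x y)) : x ∈ geD G := by
  classical
  obtain ⟨M, hM, hc⟩ := exists_isMatchingSet_card_eq_matchingNumber (G ⊔ edge x y)
  have hE : IsMatchingSet G (M.erase s(x, y)) := by
    refine ⟨fun e he => ?_, (hM.subset (Finset.erase_subset _ _)).2⟩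
    have h' := hM.1 e (Finset.mem_of_mem_erase he)
    rw [edgeSet_sup] at h'
    refine h'.resolve_right fun h'' => Finset.ne_of_mem_erase he ?_
    exact edgeSet_edge_subset h''
  by_cases hxy : s(x, y) ∈ M
  · refine hE.mem_geD ?_ fun e he =>
      hM.2 _ hxy e (Finset.mem_of_mem_erase he) (Finset.ne_of_mem_erase he).symm x
        (Sym2.mem_mk_left _ _)
    have := Finset.card_erase_add_one hxy
    omega
  · rw [Finset.erase_eq_of_notMem hxy] at hE
    have := hE.card_le_matchingNumber
    omega

end GallaiEdmonds

/-- **Lemma 2.4 (`CD`-saturation).** If `H` is an `s`-connector and `G ≤ H` is a spanning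
subgraph, then there is a graph `G'` with `G ≤ G' ≤ H` and `ν(G') = ν(G)` such that `H` has
no edge between `C'` and `D'`, where `GE(G') = (C', A', D')`, and either `|C'| < s` or
`|C'| > |V| - 2s`. -/
theorem CD_saturation {V : Type*} [Fintype V] (s : ℕ) (H G : SimpleGraph V)
    (hH : IsConnector H s) (hGH : G ≤ H) :
    ∃ G' : SimpleGraph V, G ≤ G' ∧ G' ≤ H ∧ matchingNumber G' = matchingNumber G ∧
      (∀ x ∈ geC G', ∀ y ∈ geD G', ¬ H.Adj x y) ∧
      (((geC G').ncard : ℤ) < s ∨ (Fintype.card V : ℤ) - 2 * s < ((geC G').ncard : ℤ)) := by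
  obtain ⟨G', -, hmax⟩ := (Set.toFinite {K : SimpleGraph V | G ≤ K ∧ K ≤ H ∧
    matchingNumber K = matchingNumber G}).exists_le_maximal
      (show G ∈ _ from ⟨le_rfl, hGH, rfl⟩)
  obtain ⟨hGG', hG'H, hν⟩ := hmax.prop
  have hCD : ∀ x ∈ geC G', ∀ y ∈ geD G', ¬ H.Adj x y := by
    intro x hx y hy hxy
    have hnot : ¬ G'.Adj x y := fun h => hx.2 ⟨hx.1, y, hy, h⟩
    have hle : G' ≤ G' ⊔ edge x y := le_sup_left
    refine hx.1 (mem_geD_of_matchingNumber_lt (y := y)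
      (lt_of_le_of_ne (matchingNumber_mono hle) fun heq => hnot ?_))
    refine hmax.le_of_ge ⟨hGG'.trans hle, sup_le hG'H ?_, heq ▸ hν⟩ hle
      (Or.inr (by simp [edge_adj, hxy.ne]))
    rw [edge_le_iff]
    exact Or.inr hxy
  refine ⟨G', hGG', hG'H, hν, hCD, ?_⟩
  by_contra! hcon
  have hdisj : Disjoint (geC G') (geD G') := Set.disjoint_left.2 fun _ hx => hx.1
  have hD : (geD G').ncard < s := by
    by_contra! hD
    obtain ⟨x, hx, y, hy, hxy⟩ := hH _ _ hdisj (by exact_mod_cast hcon.1) hD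
    exact hCD x hx y hy hxy
  have hA := ncard_geA_le_ncard_geD G'
  have hV := card_le_ncard_geC_add_ncard_geA_add_ncard_geD G'
  omega
end
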